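/- Let B be the symmetric bilinear form on ℝ² with B(e₁,e₁)=108, B(e₁,e₂)=B(e₂,e₁)=45, B(e₂,e₂)=27, and for λ ∈ ℝ let C_λ = {a·(0,1) + b·(1,−λ) : a,b ≥ 0} ⊆ ℝ². Then for every λ with 1 ≤ λ ≤ 8/5, the dual cone {w ∈ ℝ² : B(w,v) ≥ 0 for all v ∈ C_λ} strictly contains C_λ. -/

import Mathlib

/-- The cone `C_λ = {a·(0,1) + b·(1,−λ) : a, b ≥ 0} ⊆ ℝ²`. -/
def coneLam (lam : ℝ) : Set (Fin 2 → ℝ) :=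
  {p | ∃ a b : ℝ, 0 ≤ a ∧ 0 ≤ b ∧ p = a • ![0, 1] + b • ![1, -lam]}

/-- A bilinear form on `ℝ²` in terms of its values on the standard basis. -/
theorem bilinForm_fin_two_apply (B : LinearMap.BilinForm ℝ (Fin 2 → ℝ)) (x y z w : ℝ) :
    B ![x, y] ![z, w] = x * z * B ![1, 0] ![1, 0] + x * w * B ![1, 0] ![0, 1]
      + y * z * B ![0, 1] ![1, 0] + y * w * B ![0, 1] ![0, 1] := by
  have h (s t : ℝ) : ![s, t] = s • ![(1 : ℝ), 0] + t • ![(0 : ℝ), 1] := by simp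
  rw [h x y, h z w]
  simp only [map_add, map_smul, LinearMap.add_apply, LinearMap.smul_apply, smul_eq_mul]
  ring

/-- Membership in the dual cone can be tested on the two generators. -/
theorem forall_mem_coneLam_nonneg_iff (B : LinearMap.BilinForm ℝ (Fin 2 → ℝ)) (lam : ℝ)
    (w : Fin 2 → ℝ) :
    (∀ v ∈ coneLam lam, 0 ≤ B w v) ↔ 0 ≤ B w ![0, 1] ∧ 0 ≤ B w ![1, -lam] := by
  constructor
  · intro h
    exact ⟨h _ ⟨1, 0, by simp⟩, h _ ⟨0, 1, by simp⟩⟩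
  · rintro ⟨h₁, h₂⟩ _ ⟨a, b, ha, hb, rfl⟩
    rw [map_add, map_smul, map_smul, smul_eq_mul, smul_eq_mul]
    positivity

/-- For `B` the symmetric bilinear form on ℝ² with `B(e₁,e₁)=108`, `B(e₁,e₂)=B(e₂,e₁)=45`,
`B(e₂,e₂)=27`, and every `λ` with `1 ≤ λ ≤ 8/5`, the dual cone
`{w : B(w,v) ≥ 0 for all v ∈ C_λ}` strictly contains `C_λ`. -/
theorem stmt_3 (B : LinearMap.BilinForm ℝ (Fin 2 → ℝ))
    (hsymm : ∀ u v : Fin 2 → ℝ, B u v = B v u)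
    (h11 : B ![1, 0] ![1, 0] = 108) (h12 : B ![1, 0] ![0, 1] = 45)
    (h21 : B ![0, 1] ![1, 0] = 45) (h22 : B ![0, 1] ![0, 1] = 27)
    (lam : ℝ) (hlam1 : 1 ≤ lam) (hlam2 : lam ≤ 8 / 5) :
    coneLam lam ⊂ {w : Fin 2 → ℝ | ∀ v ∈ coneLam lam, 0 ≤ B w v} := by
  have hB (x y z w : ℝ) :
      B ![x, y] ![z, w] = 108 * (x * z) + 45 * (x * w + y * z) + 27 * (y * w) := by
    rw [bilinForm_fin_two_apply, h11, h12, h21, h22]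
    ring
  simp only [forall_mem_coneLam_nonneg_iff]
  refine Set.ssubset_iff_exists.2 ⟨?_, ![-1, 50 + lam], ?_, ?_⟩
  · rintro _ ⟨a, b, ha, hb, rfl⟩
    have hmixed : 0 ≤ 45 - 27 * lam := by linarith
    have hself : 0 ≤ 108 - 90 * lam + 27 * lam ^ 2 := by nlinarith [sq_nonneg (3 * lam - 5)]
    simp only [Set.mem_ofPred_eq, map_add, map_smul, LinearMap.add_apply, LinearMap.smul_apply,
      smul_eq_mul, hB]
    constructor
    · linear_combination 27 * ha + mul_nonneg hb hmixed
    · linear_combination mul_nonneg ha hmixed + mul_nonneg hb hself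
  · simp only [Set.mem_ofPred_eq, hB]
    constructor <;> nlinarith
  · rintro ⟨a, b, -, hb, h⟩
    have h0 : -1 = b := by simpa using congrFun h 0
    linarith
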